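/- Let m ≥ 4 and n = 2^m. For any pair of distinct codewords x, y ∈ RM(m,1) having the same first bit (x_1 = y_1), the coefficients satisfy |α_x − α_y| − |β_x − γ_y| ≥ 0.06 − 4·Σ_{k=16}^{n/2} k·(1/2)^k. -/

import Mathlib

open Finset

/-- Number of deletions in a deletion pattern (number of `1`s in `ω`). -/
def wt {n : ℕ} (ω : Fin n → Bool) : ℕ := (univ.filter fun j => ω j = true).card

/-- Trace of `x` under deletion pattern `ω`: the subsequence of bits `x j`
at the positions `j` with `ω j = 0`, in increasing order of position. -/
def trc {n : ℕ} (x ω : Fin n → Bool) : List Bool :=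
  ((List.finRange n).filter fun j => ω j = false).map x

/-- Total number of runs (maximal blocks of equal bits) in a binary list. -/
def numRuns (l : List Bool) : ℕ := (l.destutter (· ≠ ·)).length

/-- Number of runs of `0`s in a binary list. -/
def numZeroRuns (l : List Bool) : ℕ := (l.destutter (· ≠ ·)).count false

/-- Number of runs of `1`s in a binary list. -/
def numOneRuns (l : List Bool) : ℕ := (l.destutter (· ≠ ·)).count true

/-- The first-order Reed-Muller code `RM(m,1)`: evaluation vectors of affine
Boolean polynomials `u₀ + u₁x₁ + ⋯ + u_mx_m`, coordinates indexed by the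
`2^m` evaluation points in lexicographic order. -/
def RM1 (m : ℕ) : Set (Fin (2 ^ m) → Bool) :=
  { x | ∃ (u0 : Bool) (u : Fin m → Bool), ∀ t : Fin (2 ^ m),
      x t = (u0 ^^ decide ((univ.filter fun i : Fin m =>
        u i = true ∧ (t : ℕ).testBit (i : ℕ) = true).card % 2 = 1)) }

/-- The coefficient `α_x`. -/
noncomputable def alphaC {n : ℕ} (x : Fin n → Bool) : ℝ :=
  (∑ i ∈ univ.filter (fun i : Fin n => x i = false),
     ∑ j ∈ univ.filter (fun j : Fin n => x j = false ∧ i < j),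
       ((1:ℝ)/2) ^ ((j : ℕ) - (i : ℕ)))
  + ∑ i ∈ univ.filter (fun i : Fin n => x i = true),
      ∑ j ∈ univ.filter (fun j : Fin n => x j = true ∧ i < j),
        ((1:ℝ)/2) ^ ((j : ℕ) - (i : ℕ))

/-- The coefficient `β_x`. -/
noncomputable def betaC {n : ℕ} (x : Fin n → Bool) : ℝ :=
  (∑ i ∈ univ.filter (fun i : Fin n => x i = false),
     ∑ j ∈ univ.filter (fun j : Fin n => x j = false ∧ i < j),
       ((1:ℝ)/2) ^ (n - ((j : ℕ) - (i : ℕ))))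
  + ∑ i ∈ univ.filter (fun i : Fin n => x i = true),
      ∑ j ∈ univ.filter (fun j : Fin n => x j = true ∧ i < j),
        ((1:ℝ)/2) ^ (n - ((j : ℕ) - (i : ℕ)))

/-- The coefficient `γ_x`. -/
noncomputable def gammaC {n : ℕ} (x : Fin n → Bool) : ℝ :=
  (∑ i ∈ univ.filter (fun i : Fin n => x i = false),
     ∑ j ∈ univ.filter (fun j : Fin n => x j = true ∧ i < j),
       ((1:ℝ)/2) ^ (n - ((j : ℕ) - (i : ℕ))))
  + ∑ i ∈ univ.filter (fun i : Fin n => x i = true),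
      ∑ j ∈ univ.filter (fun j : Fin n => x j = false ∧ i < j),
        ((1:ℝ)/2) ^ (n - ((j : ℕ) - (i : ℕ)))

/-- The coefficient `δ_x`. -/
noncomputable def deltaC {n : ℕ} (x : Fin n → Bool) : ℝ :=
  (∑ i ∈ univ.filter (fun i : Fin n => x i = false),
     ∑ j ∈ univ.filter (fun j : Fin n => x j = true ∧ i < j),
       ((1:ℝ)/2) ^ ((j : ℕ) - (i : ℕ)))
  + ∑ i ∈ univ.filter (fun i : Fin n => x i = true),
      ∑ j ∈ univ.filter (fun j : Fin n => x j = false ∧ i < j),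
        ((1:ℝ)/2) ^ ((j : ℕ) - (i : ℕ))

/-- The `±1`-valued character of `ℕ` attached to the signs `s 0, …, s (k - 1)` of the binary
digits. -/
noncomputable def digitChar (s : ℕ → ℝ) (k t : ℕ) : ℝ :=
  ∏ i ∈ range k, if t.testBit i = true then s i else 1

lemma digitChar_succ_of_lt (s : ℕ → ℝ) {k t : ℕ} (ht : t < 2 ^ k) :
    digitChar s (k + 1) t = digitChar s k t := by
  simp [digitChar, prod_range_succ, Nat.testBit_lt_two_pow ht]

lemma digitChar_succ_add (s : ℕ → ℝ) {k t : ℕ} (ht : t < 2 ^ k) :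
    digitChar s (k + 1) (2 ^ k + t) = s k * digitChar s k t := by
  have h1 : (2 ^ k + t).testBit k = true := by
    rw [Nat.testBit_two_pow_add_eq, Nat.testBit_lt_two_pow ht]; rfl
  rw [digitChar, prod_range_succ, h1, if_pos rfl, mul_comm, digitChar]
  congr 1
  refine prod_congr rfl fun i hi => ?_
  rw [Nat.testBit_two_pow_add_gt (mem_range.mp hi)]

/-- The weighted sum of the aperiodic autocorrelations of `σ 0, …, σ (N - 1)`. -/
noncomputable def corrSum (σ : ℕ → ℝ) (N : ℕ) : ℝ :=
  ∑ i ∈ range N, ∑ j ∈ range N, if i < j then σ i * σ j * (1 / 2 : ℝ) ^ (j - i) else 0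

/-- The sum of the aperiodic autocorrelations of `σ 0, …, σ (N - 1)` with reversed weights. -/
noncomputable def revCorrSum (σ : ℕ → ℝ) (N : ℕ) : ℝ :=
  ∑ i ∈ range N, ∑ j ∈ range N, if i < j then σ i * σ j * (1 / 2 : ℝ) ^ (N - (j - i)) else 0

/-- The sum of the autocorrelations of `σ 0, …, σ (N - 1)` over all pairs of positions. -/
noncomputable def crossSum (σ : ℕ → ℝ) (N : ℕ) : ℝ :=
  ∑ i ∈ range N, ∑ j ∈ range N, σ i * σ j * (1 / 2 : ℝ) ^ (N + j - i)

lemma crossSum_eq_mul (σ : ℕ → ℝ) (N : ℕ) :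
    crossSum σ N = (1 / 2 : ℝ) ^ N * (∑ i ∈ range N, σ i * 2 ^ i) *
      ∑ j ∈ range N, σ j * (1 / 2 : ℝ) ^ j := by
  rw [mul_assoc, sum_mul_sum, mul_sum, crossSum]
  refine sum_congr rfl fun i hi => ?_
  rw [mul_sum]
  refine sum_congr rfl fun j _ => ?_
  have hi' := mem_range.mp hi
  have h : (1 / 2 : ℝ) ^ (N + j) = (1 / 2 : ℝ) ^ (N + j - i) * (1 / 2 : ℝ) ^ i := by
    rw [← pow_add]; congr 1; omega
  have h2 : (1 / 2 : ℝ) ^ i * 2 ^ i = 1 := by rw [← mul_pow]; norm_num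
  have h3 : (1 / 2 : ℝ) ^ (N + j - i) = (1 / 2 : ℝ) ^ N * (1 / 2 : ℝ) ^ j * 2 ^ i := by
    rw [← pow_add, h, mul_assoc, h2, mul_one]
  rw [h3]; ring

lemma revCorrSum_eq (σ : ℕ → ℝ) (N : ℕ) (hσ : ∀ i, i < N → σ i * σ i = 1) :
    revCorrSum σ N = crossSum σ N - (1 / 2 : ℝ) ^ N * (N + corrSum σ N) := by
  have hr : revCorrSum σ N =
      ∑ i ∈ range N, ∑ j ∈ range N,
        if j < i then σ i * σ j * (1 / 2 : ℝ) ^ (N - (i - j)) else 0 := by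
    rw [revCorrSum, sum_comm]
    refine sum_congr rfl fun i _ => sum_congr rfl fun j _ => ?_
    rw [mul_comm (σ i)]
  have hN : (N : ℝ) = ∑ i ∈ range N, ∑ j ∈ range N, if i = j then σ i * σ j else 0 := by
    have : ∀ i ∈ range N, (∑ j ∈ range N, if i = j then σ i * σ j else 0) = 1 := by
      intro i hi
      rw [sum_ite_eq, if_pos hi, hσ i (mem_range.mp hi)]
    rw [sum_congr rfl this]; simp
  rw [eq_sub_iff_add_eq, hr]
  conv_lhs => rw [hN]
  rw [corrSum, ← sum_add_distrib, mul_sum, crossSum, ← sum_add_distrib]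
  refine sum_congr rfl fun i hi => ?_
  rw [← sum_add_distrib, mul_sum, ← sum_add_distrib]
  refine sum_congr rfl fun j hj => ?_
  have hi' := mem_range.mp hi
  have hj' := mem_range.mp hj
  rcases lt_trichotomy i j with h | h | h
  · rw [if_neg (by omega), if_neg (by omega), if_pos h,
      show N + j - i = N + (j - i) by omega, pow_add]
    ring
  · subst h
    simp [mul_comm]
  · rw [if_pos h, if_neg (by omega), if_neg (by omega),
      show N + j - i = N - (i - j) by omega]
    ring

lemma corrSum_two_mul {σ τ : ℕ → ℝ} {N : ℕ} {s : ℝ} (hs : s * s = 1)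
    (h0 : ∀ t < N, τ t = σ t) (h1 : ∀ t < N, τ (N + t) = s * σ t) :
    corrSum τ (N + N) = 2 * corrSum σ N + s * crossSum σ N := by
  rw [corrSum, sum_range_add]
  have low : ∀ i ∈ range N, (∑ j ∈ range (N + N),
      if i < j then τ i * τ j * (1 / 2 : ℝ) ^ (j - i) else 0) =
      (∑ j ∈ range N, if i < j then σ i * σ j * (1 / 2 : ℝ) ^ (j - i) else 0) +
      s * ∑ j ∈ range N, σ i * σ j * (1 / 2 : ℝ) ^ (N + j - i) := by
    intro i hi
    have hi' := mem_range.mp hi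
    rw [sum_range_add, mul_sum]
    congr 1
    · refine sum_congr rfl fun j hj => ?_
      rw [h0 i hi', h0 j (mem_range.mp hj)]
    · refine sum_congr rfl fun j hj => ?_
      rw [h0 i hi', h1 j (mem_range.mp hj), if_pos (by omega)]
      ring
  have high : ∀ i ∈ range N, (∑ j ∈ range (N + N),
      if N + i < j then τ (N + i) * τ j * (1 / 2 : ℝ) ^ (j - (N + i)) else 0) =
      ∑ j ∈ range N, if i < j then σ i * σ j * (1 / 2 : ℝ) ^ (j - i) else 0 := by
    intro i hi
    have hi' := mem_range.mp hi
    rw [sum_range_add, sum_eq_zero, zero_add]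
    · refine sum_congr rfl fun j hj => ?_
      rw [h1 i hi', h1 j (mem_range.mp hj), Nat.add_sub_add_left]
      simp only [Nat.add_lt_add_iff_left]
      congr 1
      linear_combination (σ i * σ j * (1 / 2 : ℝ) ^ (j - i)) * hs
    · intro j hj
      have := mem_range.mp hj
      rw [if_neg (by omega)]
  rw [sum_congr rfl low, sum_congr rfl high, sum_add_distrib, ← mul_sum, corrSum, crossSum]
  ring

lemma crossSum_two_mul {σ τ : ℕ → ℝ} {N : ℕ} {s : ℝ} (hs : s * s = 1)
    (h0 : ∀ t < N, τ t = σ t) (h1 : ∀ t < N, τ (N + t) = s * σ t) :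
    crossSum τ (N + N) = s * crossSum σ N * (1 + s * (1 / 2 : ℝ) ^ N) ^ 2 := by
  have key (w : ℝ) : ∑ i ∈ range (N + N), τ i * w ^ i =
      (1 + s * w ^ N) * ∑ i ∈ range N, σ i * w ^ i := by
    rw [sum_range_add, add_mul, one_mul, mul_sum]
    congr 1
    · exact sum_congr rfl fun i hi => by rw [h0 i (mem_range.mp hi)]
    · exact sum_congr rfl fun i hi => by rw [h1 i (mem_range.mp hi), pow_add]; ring
  have hp : (1 / 2 : ℝ) ^ N * 2 ^ N = 1 := by rw [← mul_pow]; norm_num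
  rw [crossSum_eq_mul, crossSum_eq_mul, key, key, pow_add]
  set A := ∑ i ∈ range N, σ i * (2 : ℝ) ^ i
  set B := ∑ i ∈ range N, σ i * (1 / 2 : ℝ) ^ i
  set z := (1 / 2 : ℝ) ^ N
  linear_combination (z * A * B * (1 + s * z) * s) * hp - (z * A * B * (1 + s * z) * z) * hs

/-- The recursion satisfied by `crossSum` of a digit character. -/
noncomputable def crossRec (s : ℕ → ℝ) : ℕ → ℝ
  | 0 => 1 / 2
  | k + 1 => s k * crossRec s k * (1 + s k * (1 / 2 : ℝ) ^ 2 ^ k) ^ 2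

/-- The recursion satisfied by `corrSum` of a digit character. -/
noncomputable def corrRec (s : ℕ → ℝ) : ℕ → ℝ
  | 0 => 0
  | k + 1 => 2 * corrRec s k + s k * crossRec s k

lemma crossSum_digitChar {s : ℕ → ℝ} (hs : ∀ i, s i * s i = 1) (k : ℕ) :
    crossSum (digitChar s k) (2 ^ k) = crossRec s k := by
  induction k with
  | zero => simp [crossSum, crossRec, digitChar]
  | succ k ih =>
    rw [pow_succ, mul_two, crossSum_two_mul (hs k) (fun t => digitChar_succ_of_lt s)
      (fun t => digitChar_succ_add s), ih, crossRec]

lemma corrSum_digitChar {s : ℕ → ℝ} (hs : ∀ i, s i * s i = 1) (k : ℕ) :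
    corrSum (digitChar s k) (2 ^ k) = corrRec s k := by
  induction k with
  | zero => simp [corrSum, corrRec]
  | succ k ih =>
    rw [pow_succ, mul_two, corrSum_two_mul (hs k) (fun t => digitChar_succ_of_lt s)
      (fun t => digitChar_succ_add s), ih, crossSum_digitChar hs, corrRec]

lemma revCorrSum_digitChar {s : ℕ → ℝ} (hs : ∀ i, s i * s i = 1) (k : ℕ) :
    revCorrSum (digitChar s k) (2 ^ k) =
      crossRec s k - (1 / 2 : ℝ) ^ 2 ^ k * (2 ^ k + corrRec s k) := by
  rw [revCorrSum_eq, crossSum_digitChar hs, corrSum_digitChar hs]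
  · push_cast; rfl
  · intro t _
    rw [digitChar, ← prod_mul_distrib]
    refine prod_eq_one fun i _ => ?_
    split_ifs
    · exact hs i
    · norm_num

lemma sum_agree_pairs {n : ℕ} {x : Fin n → Bool} {X : Fin n → ℝ}
    (hX : ∀ i, X i = if x i = true then -1 else 1) (w : Fin n → Fin n → ℝ) :
    (∑ i ∈ univ.filter (fun i : Fin n => x i = false),
      ∑ j ∈ univ.filter (fun j : Fin n => x j = false ∧ i < j), w i j) +
    (∑ i ∈ univ.filter (fun i : Fin n => x i = true),
      ∑ j ∈ univ.filter (fun j : Fin n => x j = true ∧ i < j), w i j) =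
    ((∑ i, ∑ j, if i < j then w i j else 0) +
      ∑ i, ∑ j, if i < j then X i * X j * w i j else 0) / 2 := by
  simp only [sum_filter]
  rw [← sum_add_distrib, ← sum_add_distrib, sum_div]
  refine sum_congr rfl fun i _ => ?_
  rw [← sum_add_distrib, sum_div]
  cases hi : x i <;> simp only [hi, if_true, Bool.true_eq_false, Bool.false_eq_true, if_false,
    zero_add, add_zero, hX] <;> refine sum_congr rfl fun j _ => ?_ <;>
    cases hj : x j <;> by_cases hij : i < j <;> simp [hij]

lemma sum_disagree_pairs {n : ℕ} {x : Fin n → Bool} {X : Fin n → ℝ}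
    (hX : ∀ i, X i = if x i = true then -1 else 1) (w : Fin n → Fin n → ℝ) :
    (∑ i ∈ univ.filter (fun i : Fin n => x i = false),
      ∑ j ∈ univ.filter (fun j : Fin n => x j = true ∧ i < j), w i j) +
    (∑ i ∈ univ.filter (fun i : Fin n => x i = true),
      ∑ j ∈ univ.filter (fun j : Fin n => x j = false ∧ i < j), w i j) =
    ((∑ i, ∑ j, if i < j then w i j else 0) -
      ∑ i, ∑ j, if i < j then X i * X j * w i j else 0) / 2 := by
  simp only [sum_filter]
  rw [← sum_add_distrib, ← sum_sub_distrib, sum_div]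
  refine sum_congr rfl fun i _ => ?_
  rw [← sum_sub_distrib, sum_div]
  cases hi : x i <;> simp only [hi, if_true, Bool.true_eq_false, Bool.false_eq_true, if_false,
    zero_add, add_zero, hX] <;> refine sum_congr rfl fun j _ => ?_ <;>
    cases hj : x j <;> by_cases hij : i < j <;> simp [hij]

lemma alphaC_eq {n : ℕ} {x : Fin n → Bool} {σ : ℕ → ℝ} {c : ℝ} (hc : c * c = 1)
    (hσ : ∀ t : Fin n, c * σ t = if x t = true then -1 else 1) :
    alphaC x = ((∑ i : Fin n, ∑ j : Fin n, if i < j then (1 / 2 : ℝ) ^ ((j : ℕ) - i) else 0)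
      + corrSum σ n) / 2 := by
  rw [alphaC, sum_agree_pairs hσ, corrSum, Finset.sum_range]
  simp only [Finset.sum_range, Fin.lt_def]
  simp only [mul_mul_mul_comm c, hc, one_mul]

lemma betaC_eq {n : ℕ} {x : Fin n → Bool} {σ : ℕ → ℝ} {c : ℝ} (hc : c * c = 1)
    (hσ : ∀ t : Fin n, c * σ t = if x t = true then -1 else 1) :
    betaC x = ((∑ i : Fin n, ∑ j : Fin n,
      if i < j then (1 / 2 : ℝ) ^ (n - ((j : ℕ) - i)) else 0) + revCorrSum σ n) / 2 := by
  rw [betaC, sum_agree_pairs hσ, revCorrSum, Finset.sum_range]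
  simp only [Finset.sum_range, Fin.lt_def]
  simp only [mul_mul_mul_comm c, hc, one_mul]

lemma gammaC_eq {n : ℕ} {x : Fin n → Bool} {σ : ℕ → ℝ} {c : ℝ} (hc : c * c = 1)
    (hσ : ∀ t : Fin n, c * σ t = if x t = true then -1 else 1) :
    gammaC x = ((∑ i : Fin n, ∑ j : Fin n,
      if i < j then (1 / 2 : ℝ) ^ (n - ((j : ℕ) - i)) else 0) - revCorrSum σ n) / 2 := by
  rw [gammaC, sum_disagree_pairs hσ, revCorrSum, Finset.sum_range]
  simp only [Finset.sum_range, Fin.lt_def]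
  simp only [mul_mul_mul_comm c, hc, one_mul]

lemma exists_digitChar_of_mem_RM1 {m : ℕ} {x : Fin (2 ^ m) → Bool} (hx : x ∈ RM1 m) :
    ∃ (c : ℝ) (s : ℕ → ℝ), c * c = 1 ∧ (∀ i, s i = 1 ∨ s i = -1) ∧
      ∀ t : Fin (2 ^ m), c * digitChar s m t = if x t = true then -1 else 1 := by
  obtain ⟨u0, u, hu⟩ := hx
  refine ⟨if u0 = true then -1 else 1,
    fun i => if h : i < m then (if u ⟨i, h⟩ = true then -1 else 1) else 1, ?_, ?_, ?_⟩
  · split_ifs <;> norm_num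
  · intro i
    dsimp only
    split_ifs <;> simp
  · intro t
    have hprod : digitChar (fun i => if h : i < m then (if u ⟨i, h⟩ = true then -1 else 1) else 1)
        m t = (-1) ^ (univ.filter fun i : Fin m =>
          u i = true ∧ (t : ℕ).testBit (i : ℕ) = true).card := by
      rw [digitChar, Finset.prod_range, ← prod_const, prod_filter]
      refine prod_congr rfl fun i _ => ?_
      by_cases h1 : u i = true <;> by_cases h2 : (t : ℕ).testBit i = true <;> simp [h1, h2]
    rw [hprod, hu t]
    generalize (univ.filter fun i : Fin m =>
          u i = true ∧ (t : ℕ).testBit (i : ℕ) = true).card = r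
    rcases Nat.even_or_odd r with h | h
    · have h' : r % 2 = 0 := Nat.even_iff.mp h
      rw [h.neg_one_pow]
      cases u0 <;> simp [h']
    · have h' : r % 2 = 1 := Nat.odd_iff.mp h
      rw [h.neg_one_pow]
      cases u0 <;> simp [h']

lemma digitChar_zero_right (s : ℕ → ℝ) (k : ℕ) : digitChar s k 0 = 1 := by
  simp [digitChar]

lemma digitChar_congr {s v : ℕ → ℝ} {k : ℕ} (h : ∀ i < k, s i = v i) (t : ℕ) :
    digitChar s k t = digitChar v k t :=
  prod_congr rfl fun i hi => by rw [h i (mem_range.mp hi)]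

lemma crossRec_congr {s v : ℕ → ℝ} {k : ℕ} (h : ∀ i < k, s i = v i) :
    crossRec s k = crossRec v k := by
  induction k with
  | zero => rfl
  | succ k ih => rw [crossRec, crossRec, ih fun i hi => h i (by omega), h k (by omega)]

lemma corrRec_congr {s v : ℕ → ℝ} {k : ℕ} (h : ∀ i < k, s i = v i) :
    corrRec s k = corrRec v k := by
  induction k with
  | zero => rfl
  | succ k ih =>
    rw [corrRec, corrRec, ih fun i hi => h i (by omega), h k (by omega),
      crossRec_congr fun i hi => h i (by omega)]

lemma half_pow_two_pow_succ (k : ℕ) :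
    (1 / 2 : ℝ) ^ 2 ^ (k + 1) = ((1 / 2 : ℝ) ^ 2 ^ k) ^ 2 := by
  rw [pow_succ 2 k, pow_mul]

lemma half_pow_two_pow_le {j k : ℕ} (h : j ≤ k) : (1 / 2 : ℝ) ^ 2 ^ k ≤ (1 / 2 : ℝ) ^ 2 ^ j :=
  pow_le_pow_of_le_one (by norm_num) (by norm_num) (Nat.pow_le_pow_right (by norm_num) h)

lemma abs_crossRec_succ {s : ℕ → ℝ} (hs : ∀ i, s i = 1 ∨ s i = -1) (k : ℕ) :
    |crossRec s (k + 1)| = |crossRec s k| * (1 + s k * (1 / 2 : ℝ) ^ 2 ^ k) ^ 2 := by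
  have h1 : |s k| = 1 := by rcases hs k with h | h <;> rw [h] <;> norm_num
  rw [crossRec, abs_mul, abs_mul, h1, one_mul, abs_sq]

lemma abs_crossRec_le {s : ℕ → ℝ} (hs : ∀ i, s i = 1 ∨ s i = -1) (k : ℕ) :
    |crossRec s k| ≤ 2 * (1 - (1 / 2 : ℝ) ^ 2 ^ k) ^ 2 := by
  induction k with
  | zero => simp only [crossRec]; norm_num
  | succ k ih =>
    rw [abs_crossRec_succ hs, half_pow_two_pow_succ]
    have he : (0 : ℝ) < (1 / 2 : ℝ) ^ 2 ^ k := by positivity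
    set e := (1 / 2 : ℝ) ^ 2 ^ k
    have h1 : (1 + s k * e) ^ 2 ≤ (1 + e) ^ 2 := by
      rcases hs k with h | h <;> rw [h] <;> nlinarith
    calc |crossRec s k| * (1 + s k * e) ^ 2 ≤ (2 * (1 - e) ^ 2) * (1 + e) ^ 2 := by gcongr
      _ = _ := by ring

lemma abs_crossRec_le_two {s : ℕ → ℝ} (hs : ∀ i, s i = 1 ∨ s i = -1) (k : ℕ) :
    |crossRec s k| ≤ 2 := by
  have h := abs_crossRec_le hs k
  have he : (0 : ℝ) < (1 / 2 : ℝ) ^ 2 ^ k := by positivity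
  have he1 : (1 / 2 : ℝ) ^ 2 ^ k ≤ 1 := pow_le_one₀ (by norm_num) (by norm_num)
  nlinarith

lemma abs_corrRec_le {s : ℕ → ℝ} (hs : ∀ i, s i = 1 ∨ s i = -1) (k : ℕ) :
    |corrRec s (k + 1)| + 2 ≤ 5 / 4 * 2 ^ (k + 1) := by
  have habs (k : ℕ) : |corrRec s (k + 1)| ≤ 2 * |corrRec s k| + |crossRec s k| := by
    have h1 : |s k| = 1 := by rcases hs k with h | h <;> rw [h] <;> norm_num
    rw [corrRec]
    refine (abs_add_le _ _).trans ?_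
    rw [abs_mul, abs_mul, h1, one_mul, abs_two]
  induction k with
  | zero =>
    have := habs 0
    norm_num [corrRec, crossRec] at this ⊢
    linarith
  | succ k ih =>
    have h1 := habs (k + 1)
    have h2 := abs_crossRec_le_two hs (k + 1)
    rw [pow_succ]
    linarith

lemma le_abs_crossRec_two {s : ℕ → ℝ} (hs : ∀ i, s i = 1 ∨ s i = -1) :
    (9 / 128 : ℝ) ≤ |crossRec s 2| := by
  rw [abs_crossRec_succ hs, abs_crossRec_succ hs]
  simp only [crossRec]
  rcases hs 0 with h | h <;> rcases hs 1 with h' | h' <;> rw [h, h'] <;> norm_num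

lemma le_abs_crossRec_aux {s : ℕ → ℝ} (hs : ∀ i, s i = 1 ∨ s i = -1) {k : ℕ} (hk : 3 ≤ k) :
    0.0612 * (1 + 2.1 * (1 / 2 : ℝ) ^ 2 ^ k) ≤ |crossRec s k| := by
  induction k, hk using Nat.le_induction with
  | base =>
    rw [abs_crossRec_succ hs]
    have h := le_abs_crossRec_two hs
    rcases hs 2 with h' | h' <;> rw [h'] <;> norm_num at h ⊢ <;> linarith
  | succ k hk ih =>
    rw [abs_crossRec_succ hs, half_pow_two_pow_succ]
    have he : (0 : ℝ) < (1 / 2 : ℝ) ^ 2 ^ k := by positivity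
    have he' : (1 / 2 : ℝ) ^ 2 ^ k ≤ 1 / 256 := by
      have := half_pow_two_pow_le hk
      norm_num at this ⊢
      exact this
    set e := (1 / 2 : ℝ) ^ 2 ^ k
    have h1 : (1 - e) ^ 2 ≤ (1 + s k * e) ^ 2 := by
      rcases hs k with h | h <;> rw [h] <;> nlinarith
    calc (0.0612 : ℝ) * (1 + 2.1 * e ^ 2) ≤ (0.0612 * (1 + 2.1 * e)) * (1 - e) ^ 2 := by
          have h3 : 0 ≤ e * (0.1 - 5.3 * e) := mul_nonneg he.le (by linarith)
          have h4 : 0 ≤ e ^ 3 := by positivity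
          nlinarith
      _ ≤ |crossRec s k| * (1 + s k * e) ^ 2 := by gcongr

lemma le_abs_crossRec {s : ℕ → ℝ} (hs : ∀ i, s i = 1 ∨ s i = -1) {k : ℕ} (hk : 3 ≤ k) :
    0.0612 ≤ |crossRec s k| := by
  have h := le_abs_crossRec_aux hs hk
  have he : (0 : ℝ) < (1 / 2 : ℝ) ^ 2 ^ k := by positivity
  linarith

lemma two_mul_abs_sub_sub_le (a b p q : ℝ) :
    2 * |a - b| - (|p| + |q|) ≤ |2 * a + p - (2 * b + q)| := by
  have h1 : |2 * (a - b)| = 2 * |a - b| := by rw [abs_mul, abs_two]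
  have h2 := abs_add_three (2 * a + p - (2 * b + q)) (-p) q
  rw [show 2 * a + p - (2 * b + q) + -p + q = 2 * (a - b) by ring, abs_neg, h1] at h2
  linarith

lemma sq_mul_add_sq_mul_le {p a b e : ℝ} (hp : p = 1 ∨ p = -1) (ha : a = 1 ∨ a = -1)
    (hb : b = 1 ∨ b = -1) (he : 0 < e) (he' : e ≤ 1 / 2) :
    (1 + p * e) ^ 2 * (1 + a * e ^ 2) ^ 2 + (1 - p * e) ^ 2 * (1 + b * e ^ 2) ^ 2 ≤
      (1 - (e ^ 2) ^ 2) * (4 + a * (1 + p * e) ^ 2 + b * (1 - p * e) ^ 2) := by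
  have h2 : 0 ≤ e * (1 / 2 - e) := mul_nonneg he.le (by linarith)
  have h3 : 0 ≤ e ^ 2 * (1 / 2 - e) := mul_nonneg (by positivity) (by linarith)
  have h4 : 0 ≤ e ^ 3 * (1 / 2 - e) := mul_nonneg (by positivity) (by linarith)
  have h5 : 0 ≤ e ^ 4 * (1 / 2 - e) := mul_nonneg (by positivity) (by linarith)
  have h6 : 0 ≤ e ^ 5 * (1 / 2 - e) := mul_nonneg (by positivity) (by linarith)
  have h7 : 0 ≤ e ^ 4 := by positivity
  have h8 : 0 ≤ e ^ 5 := by positivity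
  have h9 : 0 ≤ (1 / 2 - e) ^ 2 := by positivity
  have h10 : 0 ≤ e * (1 / 2 - e) ^ 2 := by positivity
  rcases hp with rfl | rfl <;> rcases ha with rfl | rfl <;> rcases hb with rfl | rfl <;>
    nlinarith

/-- Two codewords whose first differing digit sign is the `j`-th: from step `j + 2` on, the
correlation sums are further apart than the size of the cross sums. -/
lemma cross_le_corr_sub {s v : ℕ → ℝ} (hs : ∀ i, s i = 1 ∨ s i = -1)
    (hv : ∀ i, v i = 1 ∨ v i = -1) {j : ℕ} (hj : ∀ i < j, s i = v i) (hne : s j ≠ v j)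
    {k : ℕ} (hk : j + 2 ≤ k) :
    |crossRec s k| + |crossRec v k| ≤
      (1 - (1 / 2 : ℝ) ^ 2 ^ k) * |corrRec s k - corrRec v k| := by
  induction k, hk using Nat.le_induction with
  | base =>
    rw [abs_crossRec_succ hs, abs_crossRec_succ hs, abs_crossRec_succ hv, abs_crossRec_succ hv]
    simp only [corrRec, half_pow_two_pow_succ]
    rw [← crossRec_congr hj, ← corrRec_congr hj]
    simp only [crossRec]
    rw [← crossRec_congr hj]
    have he : (0 : ℝ) < (1 / 2 : ℝ) ^ 2 ^ j := by positivity
    have he' : (1 / 2 : ℝ) ^ 2 ^ j ≤ 1 / 2 := by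
      have := half_pow_two_pow_le (Nat.zero_le j)
      norm_num at this ⊢
      exact this
    set e := (1 / 2 : ℝ) ^ 2 ^ j
    set h := crossRec s j
    have hD (d D A : ℝ) (h1 : D = h * d ∨ D = h * (-d))
        (h2 : A ≤ (1 - (e ^ 2) ^ 2) * d) :
        |h| * A ≤ (1 - (e ^ 2) ^ 2) * |D| := by
      have h3 : |h| * d ≤ |D| := by
        rcases h1 with h1 | h1 <;> rw [h1, abs_mul]
        · exact mul_le_mul_of_nonneg_left (le_abs_self d) (abs_nonneg h)
        · rw [abs_neg]; exact mul_le_mul_of_nonneg_left (le_abs_self d) (abs_nonneg h)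
      have h4 : 0 ≤ 1 - (e ^ 2) ^ 2 := by
        have : e ^ 2 ≤ 1 := by nlinarith
        nlinarith
      nlinarith [mul_le_mul_of_nonneg_left h2 (abs_nonneg h),
        mul_le_mul_of_nonneg_left h3 h4]
    have hvj : v j = -s j := by
      rcases hs j with h | h <;> rcases hv j with h' | h' <;> rw [h, h'] at hne ⊢ <;> simp at hne ⊢
    have hpoly := sq_mul_add_sq_mul_le (hs j) (hs (j + 1)) (hv (j + 1)) he he'
    rw [hvj]
    convert hD _ _ _ ?_ hpoly using 1
    · ring
    · rcases hs j with h' | h' <;> rw [h']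
      · left; ring
      · right; ring
  | succ k hk ih =>
    rw [abs_crossRec_succ hs, abs_crossRec_succ hv, half_pow_two_pow_succ, corrRec, corrRec]
    have he : (0 : ℝ) < (1 / 2 : ℝ) ^ 2 ^ k := by positivity
    have he' : (1 / 2 : ℝ) ^ 2 ^ k ≤ 1 := pow_le_one₀ (by norm_num) (by norm_num)
    set e := (1 / 2 : ℝ) ^ 2 ^ k
    have hfac {r : ℝ} (h : r = 1 ∨ r = -1) : (1 + r * e) ^ 2 ≤ (1 + e) ^ 2 := by
      rcases h with h | h <;> rw [h] <;> nlinarith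
    have habs {r : ℝ} (h : r = 1 ∨ r = -1) (z : ℝ) : |r * z| = |z| := by
      rcases h with h | h <;> simp [h]
    have h1 := two_mul_abs_sub_sub_le (corrRec s k) (corrRec v k) (s k * crossRec s k)
      (v k * crossRec v k)
    rw [habs (hs k), habs (hv k)] at h1
    set D := |corrRec s k - corrRec v k|
    have h3 := mul_le_mul_of_nonneg_left (hfac (hs k)) (abs_nonneg (crossRec s k))
    have h4 := mul_le_mul_of_nonneg_left (hfac (hv k)) (abs_nonneg (crossRec v k))
    have h5 : (1 + e) * D ≤
        |2 * corrRec s k + s k * crossRec s k - (2 * corrRec v k + v k * crossRec v k)| := by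
      linarith
    have h6 : 0 ≤ 1 - e ^ 2 := by nlinarith
    nlinarith [mul_le_mul_of_nonneg_right ih (sq_nonneg (1 + e)),
      mul_le_mul_of_nonneg_left h5 h6]

lemma two_pow_mul_half_pow_le {m : ℕ} (hm : 4 ≤ m) :
    (2 : ℝ) ^ m * (1 / 2 : ℝ) ^ 2 ^ m ≤ 1 / 4096 := by
  induction m, hm using Nat.le_induction with
  | base => norm_num
  | succ k hk ih =>
    have he : (0 : ℝ) < (1 / 2 : ℝ) ^ 2 ^ k := by positivity
    have he' : (1 / 2 : ℝ) ^ 2 ^ k ≤ 1 / 2 := by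
      have := half_pow_two_pow_le (Nat.zero_le k)
      norm_num at this ⊢
      exact this
    rw [half_pow_two_pow_succ, pow_succ]
    set e := (1 / 2 : ℝ) ^ 2 ^ k
    have h1 : 0 ≤ (2 : ℝ) ^ k * e := by positivity
    nlinarith

lemma abs_abs_mul_sq_sub_le {p e : ℝ} (z : ℝ) (hp : p = 1 ∨ p = -1) (he : 0 < e) :
    |p * z * (1 + p * e) ^ 2 - p * z| ≤ |z| * (2 * e + e ^ 2) := by
  have h : p * z * (1 + p * e) ^ 2 - p * z = z * (2 * e + p * e ^ 2) := by
    rcases hp with rfl | rfl <;> ring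
  rw [h, abs_mul]
  gcongr
  rw [abs_le]
  rcases hp with rfl | rfl <;> constructor <;> nlinarith

lemma corr_sub_cross_add_ge {s v : ℕ → ℝ} (hs : ∀ i, s i = 1 ∨ s i = -1)
    (hv : ∀ i, v i = 1 ∨ v i = -1) (k : ℕ) :
    2 * |corrRec s k - corrRec v k| - 2 * max |crossRec s k| |crossRec v k|
      - (2 * (1 / 2 : ℝ) ^ 2 ^ k + ((1 / 2 : ℝ) ^ 2 ^ k) ^ 2) * (|crossRec s k| + |crossRec v k|)
      ≤ |corrRec s (k + 1) - corrRec v (k + 1)| - |crossRec s (k + 1) + crossRec v (k + 1)| := by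
  have he : (0 : ℝ) < (1 / 2 : ℝ) ^ 2 ^ k := by positivity
  simp only [corrRec, crossRec]
  set e := (1 / 2 : ℝ) ^ 2 ^ k
  have habs {r : ℝ} (h : r = 1 ∨ r = -1) (z : ℝ) : |r * z| = |z| := by
    rcases h with h | h <;> simp [h]
  have h1 := abs_abs_mul_sq_sub_le (crossRec s k) (hs k) he
  have h2 := abs_abs_mul_sq_sub_le (crossRec v k) (hv k) he
  rw [← habs (hs k) (crossRec s k)] at h1 ⊢
  rw [← habs (hv k) (crossRec v k)] at h2 ⊢
  set p := s k * crossRec s k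
  set q := v k * crossRec v k
  set p' := p * (1 + s k * e) ^ 2
  set q' := q * (1 + v k * e) ^ 2
  have h3 : |p' + q'| ≤ |p + q| + |p' - p| + |q' - q| := by
    have := abs_add_three (p + q) (p' - p) (q' - q)
    rwa [show p + q + (p' - p) + (q' - q) = p' + q' by ring] at this
  have h4 : |p - q| + |p + q| ≤ 2 * max |p| |q| := by
    have := le_max_left |p| |q|
    have := le_max_right |p| |q|
    have := le_abs_self p
    have := neg_abs_le p
    have := le_abs_self q
    have := neg_abs_le q
    rcases abs_cases (p - q) with h | h <;> rcases abs_cases (p + q) with h' | h' <;> linarith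
  have h5 : 2 * |corrRec s k - corrRec v k| ≤
      |2 * corrRec s k + p - (2 * corrRec v k + q)| + |p - q| := by
    have := abs_sub (2 * corrRec s k + p - (2 * corrRec v k + q)) (p - q)
    rwa [show 2 * corrRec s k + p - (2 * corrRec v k + q) - (p - q) =
      2 * (corrRec s k - corrRec v k) by ring, abs_mul, abs_two] at this
  linarith

lemma le_abs_corrRec_sub_sub_abs_crossRec_add {s v : ℕ → ℝ} (hs : ∀ i, s i = 1 ∨ s i = -1)
    (hv : ∀ i, v i = 1 ∨ v i = -1) {j m : ℕ} (hm : 4 ≤ m) (hjm : j < m)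
    (hj : ∀ i < j, s i = v i) (hne : s j ≠ v j) :
    0.1212 ≤ |corrRec s m - corrRec v m| - |crossRec s m + crossRec v m| := by
  have hvj : v j = -s j := by
    rcases hs j with h | h <;> rcases hv j with h' | h' <;> rw [h, h'] at hne ⊢ <;> simp at hne ⊢
  have habs {r : ℝ} (h : r = 1 ∨ r = -1) (z : ℝ) : |r * z| = |z| := by
    rcases h with h | h <;> simp [h]
  have hD : |corrRec s (j + 1) - corrRec v (j + 1)| = 2 * |crossRec s j| := by
    rw [corrRec, corrRec, ← corrRec_congr hj, ← crossRec_congr hj, hvj,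
      show 2 * corrRec s j + s j * crossRec s j - (2 * corrRec s j + -s j * crossRec s j) =
        2 * (s j * crossRec s j) by ring, abs_mul, abs_two, habs (hs j)]
  obtain ⟨k, rfl⟩ : ∃ k, m = k + 1 := ⟨m - 1, by omega⟩
  have he : (0 : ℝ) < (1 / 2 : ℝ) ^ 2 ^ k := by positivity
  have he' : (1 / 2 : ℝ) ^ 2 ^ k ≤ 1 / 256 := by
    have := half_pow_two_pow_le (show 3 ≤ k by omega)
    norm_num at this ⊢
    exact this
  rcases (show j = k ∨ k = j + 1 ∨ j + 2 ≤ k by omega) with rfl | rfl | hk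
  · rw [hD]
    simp only [crossRec]
    rw [← crossRec_congr hj, hvj, show s j * crossRec s j * (1 + s j * (1 / 2) ^ 2 ^ j) ^ 2 +
      -s j * crossRec s j * (1 + -s j * (1 / 2) ^ 2 ^ j) ^ 2 =
      s j * (s j * (crossRec s j * (4 * (1 / 2) ^ 2 ^ j))) by ring, habs (hs j), habs (hs j),
      abs_mul, abs_of_pos (show 0 < 4 * (1 / 2 : ℝ) ^ 2 ^ j by positivity)]
    have := le_abs_crossRec hs (show 3 ≤ j by omega)
    nlinarith
  · refine le_trans ?_ (corr_sub_cross_add_ge hs hv (j + 1))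
    rw [hD, abs_crossRec_succ hs, abs_crossRec_succ hv, ← crossRec_congr hj]
    rw [half_pow_two_pow_succ]
    have hh : 0.0703 ≤ |crossRec s j| ∧ (1 / 2 : ℝ) ^ 2 ^ j ≤ 1 / 16 ∨
        0.0612 ≤ |crossRec s j| ∧ (1 / 2 : ℝ) ^ 2 ^ j ≤ 1 / 256 := by
      rcases (show j = 2 ∨ 3 ≤ j by omega) with rfl | h
      · left
        have := le_abs_crossRec_two hs
        constructor
        · linarith
        · norm_num
      · right
        refine ⟨le_abs_crossRec hs h, ?_⟩
        have := half_pow_two_pow_le h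
        norm_num at this ⊢
        exact this
    have hf : (0 : ℝ) < (1 / 2 : ℝ) ^ 2 ^ j := by positivity
    set f := (1 / 2 : ℝ) ^ 2 ^ j
    set h := |crossRec s j|
    have hmax : max (h * (1 + s j * f) ^ 2) (h * (1 + v j * f) ^ 2) ≤ h * (1 + f) ^ 2 := by
      refine max_le ?_ ?_ <;> refine mul_le_mul_of_nonneg_left ?_ (abs_nonneg _)
      · rcases hs j with h | h <;> rw [h] <;> nlinarith
      · rcases hv j with h | h <;> rw [h] <;> nlinarith
    have hsum : h * (1 + s j * f) ^ 2 + h * (1 + v j * f) ^ 2 = h * (2 + 2 * f ^ 2) := by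
      rw [hvj]
      rcases hs j with h | h <;> rw [h] <;> ring
    rw [hsum]
    have key : h * (2 - 4 * f - 2 * f ^ 2 - (2 * f ^ 2 + (f ^ 2) ^ 2) * (2 + 2 * f ^ 2)) ≤
        2 * (2 * h) - 2 * max (h * (1 + s j * f) ^ 2) (h * (1 + v j * f) ^ 2) -
        (2 * f ^ 2 + (f ^ 2) ^ 2) * (h * (2 + 2 * f ^ 2)) := by
      nlinarith
    refine le_trans ?_ key
    have hmono (F : ℝ) (hF : f ≤ F) : h * (2 - 4 * F - 2 * F ^ 2 -
        (2 * F ^ 2 + (F ^ 2) ^ 2) * (2 + 2 * F ^ 2)) ≤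
        h * (2 - 4 * f - 2 * f ^ 2 - (2 * f ^ 2 + (f ^ 2) ^ 2) * (2 + 2 * f ^ 2)) := by
      refine mul_le_mul_of_nonneg_left ?_ (abs_nonneg _)
      gcongr
    rcases hh with ⟨h1, h2⟩ | ⟨h1, h2⟩
    · exact le_trans (by norm_num; linarith) (hmono _ h2)
    · exact le_trans (by norm_num; linarith) (hmono _ h2)
  · refine le_trans ?_ (corr_sub_cross_add_ge hs hv k)
    have h1 := cross_le_corr_sub hs hv hj hne hk
    have h2 := le_abs_crossRec hs (show 3 ≤ k by omega)
    have h3 := le_abs_crossRec hv (show 3 ≤ k by omega)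
    have h4 := abs_crossRec_le_two hs k
    have h5 := abs_crossRec_le_two hv k
    set e := (1 / 2 : ℝ) ^ 2 ^ k
    set g := |crossRec s k|
    set g' := |crossRec v k|
    have h6 : g + g' - max g g' = min g g' := by linarith [min_add_max g g']
    have h7 : 0.0612 ≤ min g g' := le_min h2 h3
    have h8 : e * (g + g') ≤ e * |corrRec s k - corrRec v k| := by
      refine mul_le_mul_of_nonneg_left ?_ he.le
      have : 0 ≤ |corrRec s k - corrRec v k| := abs_nonneg _
      nlinarith
    have h9 : e ^ 2 * (g + g') ≤ 1 / 65536 * 4 := by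
      have : e ^ 2 ≤ 1 / 65536 := by nlinarith
      gcongr
      linarith
    linarith

lemma le_abs_corrRec_sub_sub_abs_revCorr_add {s v : ℕ → ℝ} (hs : ∀ i, s i = 1 ∨ s i = -1)
    (hv : ∀ i, v i = 1 ∨ v i = -1) {m : ℕ} (hm : 4 ≤ m) (hne : ∃ j < m, s j ≠ v j) :
    0.12 ≤ |corrRec s m - corrRec v m| -
      |(crossRec s m - (1 / 2 : ℝ) ^ 2 ^ m * (2 ^ m + corrRec s m)) +
        (crossRec v m - (1 / 2 : ℝ) ^ 2 ^ m * (2 ^ m + corrRec v m))| := by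
  classical
  have hfind := Nat.find_spec hne
  have hmin : ∀ i < Nat.find hne, s i = v i := by
    intro i hi
    by_contra hcon
    exact Nat.find_min hne hi ⟨hi.trans hfind.1, hcon⟩
  have h1 := le_abs_corrRec_sub_sub_abs_crossRec_add hs hv hm hfind.1 hmin hfind.2
  obtain ⟨k, rfl⟩ : ∃ k, m = k + 1 := ⟨m - 1, by omega⟩
  have h2 := abs_le.mp (show |corrRec s (k + 1)| ≤ 5 / 4 * 2 ^ (k + 1) by
    linarith [abs_corrRec_le hs k])
  have h3 := abs_le.mp (show |corrRec v (k + 1)| ≤ 5 / 4 * 2 ^ (k + 1) by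
    linarith [abs_corrRec_le hv k])
  have h4 := two_pow_mul_half_pow_le hm
  have he : (0 : ℝ) < (1 / 2 : ℝ) ^ 2 ^ (k + 1) := by positivity
  set e := (1 / 2 : ℝ) ^ 2 ^ (k + 1)
  set N := (2 : ℝ) ^ (k + 1)
  set E := e * (2 * N + corrRec s (k + 1) + corrRec v (k + 1)) with hE
  have h5 : |E| ≤ 4.5 / 4096 := by
    rw [abs_le]
    constructor <;> nlinarith
  have h6 := abs_sub (crossRec s (k + 1) + crossRec v (k + 1)) E
  rw [show crossRec s (k + 1) + crossRec v (k + 1) - E =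
    (crossRec s (k + 1) - e * (N + corrRec s (k + 1))) +
      (crossRec v (k + 1) - e * (N + corrRec v (k + 1))) by rw [hE]; ring] at h6
  linarith

/-- Condition (C3): for distinct `RM(m,1)` codewords sharing the same first bit,
`|α_x - α_y| - |β_x - γ_y| ≥ 0.06 - 4·Σ_{k=16}^{n/2} k (1/2)^k`. -/
theorem RM1_alpha_beta_gamma_gap (m : ℕ) (hm : 4 ≤ m) (x y : Fin (2 ^ m) → Bool)
    (hx : x ∈ RM1 m) (hy : y ∈ RM1 m) (hxy : x ≠ y)
    (hfirst : x ⟨0, by positivity⟩ = y ⟨0, by positivity⟩) :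
    0.06 - 4 * ∑ k ∈ Finset.Icc (16 : ℕ) (2 ^ m / 2), (k : ℝ) * ((1:ℝ)/2) ^ k ≤
      |alphaC x - alphaC y| - |betaC x - gammaC y| := by
  obtain ⟨c, s, hc, hs, hxs⟩ := exists_digitChar_of_mem_RM1 hx
  obtain ⟨d, v, hd, hv, hyv⟩ := exists_digitChar_of_mem_RM1 hy
  have hcd : c = d := by
    have h1 := hxs ⟨0, by positivity⟩
    have h2 := hyv ⟨0, by positivity⟩
    rw [hfirst, ← h2] at h1
    simpa [digitChar_zero_right] using h1
  have hne : ∃ j < m, s j ≠ v j := by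
    by_contra! hcon
    refine hxy (funext fun t => ?_)
    have h1 := hxs t
    rw [digitChar_congr hcon, hcd, hyv t] at h1
    cases hxt : x t <;> cases hyt : y t <;>
      first | rfl | (rw [hxt, hyt] at h1; norm_num at h1)
  have hs' : ∀ i, s i * s i = 1 := fun i => by rcases hs i with h | h <;> rw [h] <;> norm_num
  have hv' : ∀ i, v i * v i = 1 := fun i => by rcases hv i with h | h <;> rw [h] <;> norm_num
  have hgap := le_abs_corrRec_sub_sub_abs_revCorr_add hs hv hm hne
  rw [alphaC_eq hc hxs, alphaC_eq hd hyv, betaC_eq hc hxs, gammaC_eq hd hyv, ← sub_div,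
    ← sub_div, add_sub_add_left_eq_sub, add_sub_sub_cancel, abs_div, abs_div, abs_two,
    corrSum_digitChar hs', corrSum_digitChar hv', revCorrSum_digitChar hs',
    revCorrSum_digitChar hv']
  have hsum : 0 ≤ ∑ k ∈ Finset.Icc (16 : ℕ) (2 ^ m / 2), (k : ℝ) * ((1:ℝ)/2) ^ k :=
    sum_nonneg fun k _ => by positivity
  linarith
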